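/- For n ≥ 1 and k ≥ 0, the total number d(n,k) of packed words of length n with supremum k equals S(n+1,k+1)·k!, where S(n,k) is the Stirling number of the second kind. -/

import Mathlib

/-- Words over the alphabet `X = {x_i : i ≥ 0}`, identified with lists of natural numbers. -/
abbrev Word : Type := List ℕ

/-- `IAlph w` is the set of indices of letters occurring in `w`. -/
def IAlph (w : Word) : Finset ℕ := w.toFinset

/-- `wsup w` is the supremum of `IAlph w` (0 for the empty word). -/
def wsup (w : Word) : ℕ := w.foldr max 0

/-- The substitution `S_φ` replaces each letter `x_i` by `x_{φ i}`. -/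
def subst (φ : ℕ → ℕ) (w : Word) : Word := w.map φ

/-- The packing substitution `φ_w`: it sends the `m`-th smallest nonzero letter of `w` to `m`,
and `0` to `0`. -/
def packMap (w : Word) (i : ℕ) : ℕ := (((IAlph w).erase 0).filter (fun j => j ≤ i)).card

/-- `pack w = S_{φ_w} w`. -/
def pack (w : Word) : Word := subst (packMap w) w

/-- A word is packed if `pack w = w`. -/
def IsPacked (w : Word) : Prop := pack w = w

/-- `T_t`: shift every nonzero letter by `t`, fixing `x_0`. -/
def shiftW (t : ℕ) (w : Word) : Word := subst (fun n => if n = 0 then 0 else n + t) w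

/-- Shifted concatenation `u * v = u · T_{sup u}(v)`. -/
def sc (u v : Word) : Word := u ++ shiftW (wsup u) v

/-- `w[I]`: the subword of `w` formed by the letters at the (1-indexed) positions in `I`,
taken in increasing order of position. -/
def subword (w : Word) (I : Finset ℕ) : Word :=
  ((List.range w.length).filter (fun j => decide (j + 1 ∈ I))).map (fun j => w.getD j 0)

/-- Quotient by a set of indices: `w / A = S_{φ_A} w` where `φ_A i = 0` if `i ∈ A`, else `i`. -/
def quotSet (w : Word) (A : Finset ℕ) : Word := subst (fun i => if i ∈ A then 0 else i) w

/-- Quotient by a word: `w / u = w / IAlph u`. -/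
def quotWord (w u : Word) : Word := quotSet w (IAlph u)

/-- Stirling numbers of the second kind: `stirling2 n k` is the number of set partitions of
an `n`-element set into exactly `k` nonempty blocks.  They satisfy `S(0,0) = 1`,
`S(n,0) = 0` for `n > 0`, `S(0,k) = 0` for `k > 0`, and
`S(n+1,k+1) = S(n,k) + (k+1)·S(n,k+1)`. -/
def stirling2 : ℕ → ℕ → ℕ
  | 0, 0 => 1
  | 0, _ + 1 => 0
  | _ + 1, 0 => 0
  | n + 1, k + 1 => stirling2 n k + (k + 1) * stirling2 n (k + 1)

theorem le_wsup {w : Word} {i : ℕ} (hi : i ∈ w) : i ≤ wsup w := by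
  induction w with
  | nil => simp at hi
  | cons a t ih =>
    change i ≤ max a (wsup t)
    rcases List.mem_cons.1 hi with rfl | h
    · exact le_max_left _ _
    · exact (ih h).trans (le_max_right _ _)

theorem wsup_eq_zero_or_mem (w : Word) : wsup w = 0 ∨ wsup w ∈ w := by
  induction w with
  | nil => exact Or.inl rfl
  | cons a t ih =>
    change max a (wsup t) = 0 ∨ max a (wsup t) ∈ a :: t
    rw [List.mem_cons]
    rcases max_choice a (wsup t) with h | h <;> rw [h] <;> tauto

theorem isPacked_iff_packMap_eq {w : Word} : IsPacked w ↔ ∀ i ∈ w, packMap w i = i := by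
  simpa [IsPacked, pack, subst] using List.map_inj_left (f := packMap w) (g := id) (l := w)

/-- A word is packed with supremum `k` iff its letters, together with `0`, are `0, …, k`. -/
theorem isPacked_and_wsup_eq_iff (w : Word) (k : ℕ) :
    IsPacked w ∧ wsup w = k ↔ insert 0 w.toFinset = Finset.range (k + 1) := by
  rw [isPacked_iff_packMap_eq]
  constructor
  · rintro ⟨hp, rfl⟩
    have hsub : (IAlph w).erase 0 ⊆ Finset.Icc 1 (wsup w) := by
      intro j hj
      simp only [IAlph, Finset.mem_erase, List.mem_toFinset] at hj
      exact Finset.mem_Icc.2 ⟨Nat.one_le_iff_ne_zero.2 hj.1, le_wsup hj.2⟩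
    have hcard : wsup w ≤ ((IAlph w).erase 0).card := by
      rcases wsup_eq_zero_or_mem w with h | h
      · simp [h]
      · exact (hp _ h).symm.le.trans (Finset.card_filter_le _ _)
    have heq := Finset.eq_of_subset_of_card_le hsub (by simpa using hcard)
    ext j
    have hj := Finset.ext_iff.1 heq j
    simp only [IAlph, Finset.mem_erase, List.mem_toFinset, Finset.mem_Icc] at hj
    simp only [Finset.mem_insert, List.mem_toFinset, Finset.mem_range]
    rcases Nat.eq_zero_or_pos j with rfl | h
    · simp
    · grind
  · intro h
    have hmem (j : ℕ) : j = 0 ∨ j ∈ w ↔ j ≤ k := by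
      simpa [Nat.lt_succ_iff] using Finset.ext_iff.1 h j
    constructor
    · intro i hi
      have hik := (hmem i).1 (Or.inr hi)
      have : ((IAlph w).erase 0).filter (fun j => j ≤ i) = Finset.Icc 1 i := by
        ext j
        have := hmem j
        simp only [IAlph, Finset.mem_filter, Finset.mem_erase, List.mem_toFinset, Finset.mem_Icc]
        grind
      rw [packMap, this]
      simp
    · apply le_antisymm
      · exact (hmem _).1 (wsup_eq_zero_or_mem w)
      · rcases (hmem k).2 le_rfl with rfl | hk
        · exact Nat.zero_le _
        · exact le_wsup hk

/-- The words of length `n` whose letters, together with `0`, form the set `A`. -/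
def wordsWithLetters : ℕ → Finset ℕ → Finset Word
  | 0, A => if A = {0} then {[]} else ∅
  | n + 1, A => A.biUnion fun a =>
      (wordsWithLetters n A ∪ if a = 0 then ∅ else wordsWithLetters n (A.erase a)).image (a :: ·)

theorem mem_wordsWithLetters {n : ℕ} {A : Finset ℕ} {w : Word} :
    w ∈ wordsWithLetters n A ↔ w.length = n ∧ insert 0 w.toFinset = A := by
  induction n generalizing A w with
  | zero =>
    rw [wordsWithLetters, List.length_eq_zero_iff]
    split_ifs with h
    · subst h
      simp +contextual
    · simp only [Finset.notMem_empty, false_iff, not_and]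
      rintro rfl h'
      exact h (by simpa using h'.symm)
  | succ n ih =>
    cases w with
    | nil => simp [wordsWithLetters]
    | cons b t =>
      have key : b ∈ A ∧ (insert 0 t.toFinset = A ∨ b ≠ 0 ∧ insert 0 t.toFinset = A.erase b) ↔
          insert 0 (insert b t.toFinset) = A := by
        rw [Finset.insert_comm]
        generalize hB : insert 0 t.toFinset = B
        have h0 : 0 ∈ B := hB ▸ Finset.mem_insert_self _ _
        constructor
        · rintro ⟨hb, rfl | ⟨-, rfl⟩⟩
          · exact Finset.insert_eq_of_mem hb
          · exact Finset.insert_erase hb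
        · rintro rfl
          refine ⟨Finset.mem_insert_self _ _, ?_⟩
          by_cases hb : b ∈ B
          · exact Or.inl (Finset.insert_eq_of_mem hb).symm
          · exact Or.inr ⟨fun h => hb (h ▸ h0), (Finset.erase_insert hb).symm⟩
      rw [List.toFinset_cons, ← key]
      simp only [wordsWithLetters, Finset.mem_biUnion, Finset.mem_image, Finset.mem_union,
        List.cons.injEq, List.length_cons, Nat.add_right_cancel_iff]
      constructor
      · rintro ⟨a, ha, t', ht, rfl, rfl⟩
        split_ifs at ht with h <;> simp only [ih, Finset.notMem_empty] at ht <;> tauto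
      · rintro ⟨hl, hb, h⟩
        refine ⟨b, hb, t, ?_, rfl, rfl⟩
        split_ifs with h' <;> simp only [ih, Finset.notMem_empty] <;> tauto

theorem card_wordsWithLetters (n k : ℕ) {A : Finset ℕ} (h0 : 0 ∈ A) (hA : A.card = k + 1) :
    (wordsWithLetters n A).card = stirling2 (n + 1) (k + 1) * k.factorial := by
  induction n generalizing k A with
  | zero =>
    rw [wordsWithLetters]
    cases k with
    | zero =>
      obtain ⟨a, rfl⟩ := Finset.card_eq_one.1 hA
      obtain rfl := Finset.mem_singleton.1 h0
      simp [stirling2]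
    | succ k =>
      rw [if_neg (by rintro rfl; simp at hA)]
      simp [stirling2]
  | succ n ih =>
    rw [wordsWithLetters, Finset.card_biUnion]
    · have hterm (a : ℕ) (ha : a ∈ A.erase 0) :
          ((wordsWithLetters n A ∪
            if a = 0 then ∅ else wordsWithLetters n (A.erase a)).image (a :: ·)).card =
          stirling2 (n + 1) (k + 1) * k.factorial + stirling2 (n + 1) k * (k - 1).factorial := by
        obtain ⟨ha0, haA⟩ := Finset.mem_erase.1 ha
        have hne : A ≠ A.erase a := fun h => Finset.notMem_erase a A (h ▸ haA)
        rw [Finset.card_image_of_injective _ List.cons_injective, if_neg ha0,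
          Finset.card_union_of_disjoint, ih k h0 hA]
        · have hk : k ≠ 0 := by
            rintro rfl
            exact ha0 (Finset.card_le_one.1 hA.le a haA 0 h0)
          obtain ⟨m, rfl⟩ := Nat.exists_eq_succ_of_ne_zero hk
          rw [ih m (Finset.mem_erase.2 ⟨Ne.symm ha0, h0⟩)
            (by rw [Finset.card_erase_of_mem haA, hA]; rfl)]
          rfl
        · rw [Finset.disjoint_left]
          intro w hw hw'
          exact hne ((mem_wordsWithLetters.1 hw).2.symm.trans (mem_wordsWithLetters.1 hw').2)
      rw [← Finset.add_sum_erase _ _ h0, Finset.sum_congr rfl hterm, Finset.sum_const,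
        Finset.card_erase_of_mem h0, hA, Finset.card_image_of_injective _ List.cons_injective,
        if_pos rfl, Finset.union_empty, ih k h0 hA, stirling2.eq_4 (n + 1) k]
      cases k with
      | zero => simp [stirling2]
      | succ m =>
        simp only [Nat.add_sub_cancel, Nat.factorial_succ, smul_eq_mul]
        ring
    · intro a _ b _ hab
      rw [Function.onFun, Finset.disjoint_left]
      simp only [Finset.mem_image]
      rintro _ ⟨t, -, rfl⟩ ⟨t', -, h⟩
      exact hab (List.cons.inj h).1.symm

/-- For `n ≥ 1`, `k ≥ 0`, the total number `d(n,k)` of packed words of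
length `n` with supremum `k` is `S(n+1,k+1)·k!`. -/
theorem card_packed (n k : ℕ) (hn : 1 ≤ n) :
    Nat.card {w : Word // IsPacked w ∧ w.length = n ∧ wsup w = k}
      = stirling2 (n + 1) (k + 1) * Nat.factorial k := by
  rw [← card_wordsWithLetters n k (A := Finset.range (k + 1)) (by simp) (by simp)]
  refine Nat.subtype_card _ fun w => ?_
  rw [mem_wordsWithLetters, ← isPacked_and_wsup_eq_iff]
  tauto
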